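/- arXiv:2511.14915 — 2 statements merged into one kernel-verified Lean document; each statement's English description precedes it below -/
import Mathlib

section
/- Let N ≥ 2, let H be an H-matrix satisfying the H-invariance conditions P(N−1,m;H) = (1/N)·C(N,m+1) for m = 1,…,N−1, and let G₀ ∈ ℝ^{(N+1)×(N+1)} be the Gram matrix associated to the worst-case operator. If δ ∈ ℝ^{(N+1)×(N+1)} is symmetric with δ_{N+1,N+1} = 0, then the function t ↦ det(G₀ + t·δ) is differentiable at t = 0 with derivative (1/N^{N−2})·(∏_{j=1}^{N−1} h_{j,j}^{2(N−j)})·(δ_{N,N} − (2/N)·δ_{N,N+1}). -/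
open Finset

/-- `Pinv H k m` is `P(k,m;H)`: the sum over all index sequences
`1 ≤ j(1) ≤ i(1) < j(2) ≤ i(2) < ⋯ < j(m) ≤ i(m) ≤ k` of `∏_{r} h_{i(r),j(r)}`,
with `P(k,0;H) = 1`. -/
noncomputable def Pinv (H : ℕ → ℕ → ℝ) (k : ℕ) : ℕ → ℝ
  | 0 => 1
  | m + 1 =>
    ∑ f : Fin (m + 1) → Fin (k + 1) × Fin (k + 1),
      if (∀ r, 1 ≤ ((f r).2 : ℕ) ∧ ((f r).2 : ℕ) ≤ ((f r).1 : ℕ)) ∧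
          (∀ r : Fin m, ((f r.castSucc).1 : ℕ) < ((f r.succ).2 : ℕ)) then
        ∏ r, H ((f r).1 : ℕ) ((f r).2 : ℕ)
      else 0

/-- `Qinv H k m j` is `Q(k,m,j;H)`: the partial sum of `P(k,m;H)` over those index
sequences with `j(1) = j` (zero if no such sequence exists, and zero for `m = 0`). -/
noncomputable def Qinv (H : ℕ → ℕ → ℝ) (k : ℕ) : ℕ → ℕ → ℝ
  | 0, _ => 0
  | m + 1, j =>
    ∑ f : Fin (m + 1) → Fin (k + 1) × Fin (k + 1),
      if (∀ r, 1 ≤ ((f r).2 : ℕ) ∧ ((f r).2 : ℕ) ≤ ((f r).1 : ℕ)) ∧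
          (∀ r : Fin m, ((f r.castSucc).1 : ℕ) < ((f r.succ).2 : ℕ)) ∧
          ((f 0).2 : ℕ) = j then
        ∏ r, H ((f r).1 : ℕ) ((f r).2 : ℕ)
      else 0

/-- The H-certificates `λ*_{k,j}(H)`:
`λ*_{N,j}(H) = N·Σ_{m=1}^{N−j} (−1)^{m−1}·Q(N−1,m,j;H)` for `j = 1,…,N−1`, and
`λ*_{k,j}(H) = N·Σ_{ℓ=1}^{N−j} Σ_{m=1}^{N−k} (−1)^{ℓ+m−1}·C(ℓ+m,m)·Q(N−1,ℓ,j;H)·Q(N−1,m,k;H)`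
for `1 ≤ j < k ≤ N−1`. -/
noncomputable def lamStar (N : ℕ) (H : ℕ → ℕ → ℝ) (k j : ℕ) : ℝ :=
  if k = N then
    (N : ℝ) * ∑ m ∈ Finset.Icc 1 (N - j), (-1 : ℝ) ^ (m - 1) * Qinv H (N - 1) m j
  else
    (N : ℝ) * ∑ l ∈ Finset.Icc 1 (N - j), ∑ m ∈ Finset.Icc 1 (N - k),
      (-1 : ℝ) ^ (l + m - 1) * (Nat.choose (l + m) m : ℝ) *
        Qinv H (N - 1) l j * Qinv H (N - 1) m k

/-- The worst-case matrix `G ∈ ℝ^{N×N}`: diagonal entries `1/2`, subdiagonal entries `−1/2`,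
top-right entry `G_{1,N} = 1/2`, all other entries `0`. -/
noncomputable def Gmat (N : ℕ) : Matrix (Fin N) (Fin N) ℝ := Matrix.of fun i j =>
  if i = j then 1 / 2
  else if (i : ℕ) = (j : ℕ) + 1 then -(1 / 2)
  else if (i : ℕ) = 0 ∧ (j : ℕ) = N - 1 then 1 / 2
  else 0

/-- The index sequences `(i(r), j(r))` summed over in `P(k,m;H)`. -/
def indexSeqs (k m : ℕ) : Finset (Fin m → ℕ × ℕ) :=
  {f ∈ Fintype.piFinset fun _ => range (k + 1) ×ˢ range (k + 1) |
    (∀ r, 1 ≤ (f r).2 ∧ (f r).2 ≤ (f r).1) ∧ ∀ r s, r < s → (f r).1 < (f s).2}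

lemma mem_indexSeqs {k m : ℕ} {f : Fin m → ℕ × ℕ} :
    f ∈ indexSeqs k m ↔ (∀ r, 1 ≤ (f r).2 ∧ (f r).2 ≤ (f r).1 ∧ (f r).1 ≤ k) ∧
      ∀ r s, r < s → (f r).1 < (f s).2 := by
  simp only [indexSeqs, mem_filter, Fintype.mem_piFinset, mem_product, mem_range]
  refine ⟨fun ⟨h₁, h₂, h₃⟩ => ⟨fun r => ?_, h₃⟩, fun ⟨h₁, h₂⟩ => ⟨fun r => ?_, fun r => ?_, h₂⟩⟩
  · have := h₁ r; have := h₂ r; omega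
  · have := h₁ r; omega
  · have := h₁ r; omega

lemma lt_of_forall_castSucc_lt_succ {m : ℕ} {a b : Fin (m + 1) → ℕ} (hba : ∀ r, b r ≤ a r)
    (h : ∀ r : Fin m, a r.castSucc < b r.succ) {r s : Fin (m + 1)} (hrs : r < s) :
    a r < b s := by
  have ha : StrictMono a :=
    Fin.strictMono_iff_lt_succ.2 fun i => (h i).trans_le (hba i.succ)
  obtain ⟨s, rfl⟩ := Fin.exists_succ_eq.2 (Fin.ne_zero_of_lt hrs)
  exact (ha.monotone (Fin.le_castSucc_iff.2 hrs)).trans_lt (h s)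

lemma Pinv_eq_sum_indexSeqs (H : ℕ → ℕ → ℝ) (k m : ℕ) :
    Pinv H k m = ∑ f ∈ indexSeqs k m, ∏ r, H (f r).1 (f r).2 := by
  cases m with
  | zero =>
    have : indexSeqs k 0 = univ := by
      ext f
      simpa [mem_indexSeqs] using Subsingleton.elim _ _
    simp [this, Pinv]
  | succ m =>
    rw [Pinv, ← sum_filter]
    refine sum_bij' (fun f _ r => (((f r).1 : ℕ), ((f r).2 : ℕ)))
      (fun f hf r => (⟨(f r).1, by have := (mem_indexSeqs.1 hf).1 r; omega⟩,
        ⟨(f r).2, by have := (mem_indexSeqs.1 hf).1 r; omega⟩)) ?_ ?_ ?_ ?_ ?_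
    · intro f hf
      simp only [mem_filter, mem_univ, true_and] at hf
      refine mem_indexSeqs.2 ⟨fun r => ⟨(hf.1 r).1, (hf.1 r).2, by omega⟩, fun r s hrs => ?_⟩
      exact lt_of_forall_castSucc_lt_succ (a := fun r => ((f r).1 : ℕ))
        (b := fun r => ((f r).2 : ℕ)) (fun r => (hf.1 r).2) hf.2 hrs
    · intro f hf
      rw [mem_indexSeqs] at hf
      simp only [mem_filter, mem_univ, true_and]
      exact ⟨fun r => ⟨(hf.1 r).1, (hf.1 r).2.1⟩, fun r => hf.2 _ _ r.castSucc_lt_succ⟩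
    · intro f _
      rfl
    · intro f _
      rfl
    · intro f _
      rfl

lemma snoc_mem_indexSeqs {k m : ℕ} {g : Fin m → ℕ × ℕ} {p : ℕ × ℕ} :
    (Fin.snoc g p : Fin (m + 1) → ℕ × ℕ) ∈ indexSeqs k (m + 1) ↔
      1 ≤ p.2 ∧ p.2 ≤ p.1 ∧ p.1 ≤ k ∧ g ∈ indexSeqs (p.2 - 1) m := by
  simp only [mem_indexSeqs, Fin.forall_fin_succ', Fin.snoc_castSucc, Fin.snoc_last,
    Fin.castSucc_lt_castSucc_iff, Fin.castSucc_lt_last, lt_irrefl, forall_true_left,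
    not_lt_of_ge (Fin.le_last _), false_imp_iff, implies_true, and_true]
  constructor
  · rintro ⟨⟨h₁, h₂⟩, h₃⟩
    refine ⟨h₂.1, h₂.2.1, h₂.2.2, fun r => ?_, fun r => (h₃ r).1⟩
    have := h₁ r; have := (h₃ r).2; omega
  · rintro ⟨h₁, h₂, h₃, h₄, h₅⟩
    refine ⟨⟨fun r => ?_, h₁, h₂, h₃⟩, fun r => ⟨h₅ r, ?_⟩⟩
    all_goals have := h₄ r; omega

lemma Pinv_zero_right (H : ℕ → ℕ → ℝ) (k : ℕ) : Pinv H k 0 = 1 := rfl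

/-- Splitting off the last pair `(i(m+1), j(m+1))` of an index sequence. -/
lemma Pinv_succ_right (H : ℕ → ℕ → ℝ) (k m : ℕ) :
    Pinv H k (m + 1) =
      ∑ i ∈ range k, ∑ j ∈ range (i + 1), H (i + 1) (j + 1) * Pinv H j m := by
  simp only [Pinv_eq_sum_indexSeqs, mul_sum, sum_sigma']
  refine sum_bij' (fun f _ => ⟨(f (Fin.last m)).1 - 1, (f (Fin.last m)).2 - 1, Fin.init f⟩)
    (fun x _ => (Fin.snoc x.2.2 (x.1 + 1, x.2.1 + 1) : Fin (m + 1) → ℕ × ℕ)) ?_ ?_ ?_ ?_ ?_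
  · intro f hf
    rw [← Fin.snoc_init_self f, snoc_mem_indexSeqs] at hf
    simp only [mem_sigma, mem_range]
    refine ⟨?_, ?_, hf.2.2.2⟩ <;> omega
  · rintro ⟨i, j, g⟩ hx
    simp only [mem_sigma, mem_range] at hx
    exact snoc_mem_indexSeqs.2 ⟨by simp, by simp; omega, by simp; omega, by simpa using hx.2.2⟩
  · intro f hf
    rw [← Fin.snoc_init_self f, snoc_mem_indexSeqs] at hf
    conv_rhs => rw [← Fin.snoc_init_self f]
    simp only
    congr 1
    ext <;> simp only <;> omega
  · rintro ⟨i, j, g⟩ hx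
    simp
  · intro f hf
    rw [← Fin.snoc_init_self f, snoc_mem_indexSeqs] at hf
    rw [Fin.prod_univ_castSucc, mul_comm]
    simp only
    rw [Nat.sub_add_cancel (by omega), Nat.sub_add_cancel (by omega)]
    rfl

lemma Pinv_succ_succ (H : ℕ → ℕ → ℝ) (k m : ℕ) :
    Pinv H (k + 1) (m + 1) =
      Pinv H k (m + 1) + ∑ j ∈ range (k + 1), H (k + 1) (j + 1) * Pinv H j m := by
  rw [Pinv_succ_right, sum_range_succ, ← Pinv_succ_right]

lemma Pinv_eq_zero_of_lt (H : ℕ → ℕ → ℝ) {k m : ℕ} (h : k < m) : Pinv H k m = 0 := by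
  induction m generalizing k with
  | zero => omega
  | succ m ih =>
    rw [Pinv_succ_right]
    refine sum_eq_zero fun i hi => sum_eq_zero fun j hj => ?_
    rw [mem_range] at hi hj
    rw [ih (by omega), mul_zero]

open Matrix in
/-- Jacobi's formula for the derivative of the determinant along a line. -/
lemma hasDerivAt_det_add_smul {n : Type*} [Fintype n] [DecidableEq n] (A B : Matrix n n ℝ) :
    HasDerivAt (fun t : ℝ => (A + t • B).det) (A.adjugate * B).trace 0 := by
  let f : ContinuousMultilinearMap ℝ (fun _ : n => n → ℝ) ℝ :=
    ⟨(detRowAlternating (n := n) (R := ℝ)).toMultilinearMap, continuous_id.matrix_det⟩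
  have hline : HasDerivAt (fun (t : ℝ) (i j : n) => A i j + t * B i j) (fun i j => B i j) 0 :=
    hasDerivAt_pi.2 fun i => hasDerivAt_pi.2 fun j => by
      simpa using ((hasDerivAt_id (0 : ℝ)).mul_const (B i j)).const_add (A i j)
  have h := (f.hasFDerivAt fun i j => A i j + (0 : ℝ) * B i j).comp_hasDerivAt (0 : ℝ) hline
  convert! h using 1
  rw [ContinuousMultilinearMap.linearDeriv_apply, trace_mul_comm, trace]
  refine sum_congr rfl fun i _ => ?_
  change ∑ j, B i j * A.adjugate j i = (updateRow (A + (0 : ℝ) • B) i (B i)).det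
  rw [zero_smul, add_zero, ← cramer_transpose_apply]
  simp [cramer_eq_adjugate_mulVec, ← adjugate_transpose, mulVec, dotProduct, mul_comm]

open Matrix in
/-- If `W c = e_last / s`, then `adj (Wᵀ D W) = (s det W)² c cᵀ` for `D` the projection that kills
the last coordinate. -/
lemma adjugate_transpose_mul_diagonal_mul {n : ℕ} (W : Matrix (Fin (n + 1)) (Fin (n + 1)) ℝ)
    (c : Fin (n + 1) → ℝ) (s : ℝ) (hs : s ≠ 0)
    (hc : W *ᵥ c = Pi.single (Fin.last n) s⁻¹) :
    (Wᵀ * diagonal (Fin.snoc (fun _ => 1) 0) * W).adjugate =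
      (s * W.det) ^ 2 • vecMulVec c c := by
  have hcol : W.adjugate *ᵥ Pi.single (Fin.last n) 1 = (s * W.det) • c := by
    have h : s • (W *ᵥ c) = Pi.single (Fin.last n) 1 := by
      rw [hc, ← Pi.single_smul, smul_eq_mul, mul_inv_cancel₀ hs]
    rw [← h, ← mulVec_smul, mulVec_mulVec, adjugate_mul, smul_mulVec, one_mulVec, smul_smul,
      mul_comm]
  have hcol' : ∀ i, W.adjugate i (Fin.last n) = s * W.det * c i := fun i => by
    simpa using congrFun hcol i
  have hD : (diagonal (Fin.snoc (fun _ => 1) 0 : Fin (n + 1) → ℝ)).adjugate =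
      single (Fin.last n) (Fin.last n) 1 := by
    rw [adjugate_diagonal, ← diagonal_single]
    congr 1
    ext i
    refine Fin.lastCases ?_ (fun i => ?_) i
    · rw [Pi.single_eq_same]
      refine prod_eq_one fun j hj => ?_
      obtain ⟨j, rfl⟩ := Fin.exists_castSucc_eq.2 (ne_of_mem_erase hj)
      simp
    · rw [Pi.single_eq_of_ne (Fin.castSucc_ne_last i)]
      exact prod_eq_zero (mem_erase.2 ⟨(Fin.castSucc_ne_last i).symm, mem_univ _⟩) (by simp)
  rw [adjugate_mul_distrib, adjugate_mul_distrib, hD, ← adjugate_transpose]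
  ext i j
  rw [← Matrix.mul_assoc, mul_apply]
  simp only [transpose_apply]
  rw [sum_eq_single (Fin.last n)]
  · simp [hcol', vecMulVec_apply]
    ring
  · intro b _ hb
    rw [mul_single_apply_of_ne (hbj := hb), zero_mul]
  · simp

/-- The iterates are the polynomials `∑ P(k,m) A ^ m` in `A` applied to `y 0`. -/
lemma eq_sum_Pinv_smul_pow_mulVec {n : Type*} [Fintype n] [DecidableEq n] (H : ℕ → ℕ → ℝ)
    (A : Matrix n n ℝ) (y : ℕ → n → ℝ) (K : ℕ)
    (hrec : ∀ k < K, y (k + 1) =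
      y k + ∑ j ∈ range (k + 1), H (k + 1) (j + 1) • A.mulVec (y j))
    (k : ℕ) (hk : k ≤ K) (M : ℕ) (hM : k < M) :
    y k = ∑ m ∈ range M, Pinv H k m • (A ^ m).mulVec (y 0) := by
  induction k using Nat.strong_induction_on generalizing M with
  | _ k ih =>
    obtain ⟨M, rfl⟩ := Nat.exists_eq_add_of_lt hM
    cases k with
    | zero =>
      rw [zero_add, sum_range_succ', sum_eq_zero fun m _ => by
        rw [Pinv_eq_zero_of_lt H m.succ_pos, zero_smul]]
      simp [Pinv_zero_right]
    | succ k =>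
      have hA : ∀ j < k + 1, A.mulVec (y j) =
          ∑ m ∈ range (k + 1 + M), Pinv H j m • (A ^ (m + 1)).mulVec (y 0) := fun j hj => by
        rw [ih j hj (by omega) (k + 1 + M) (by omega), Matrix.mulVec_sum]
        simp [Matrix.mulVec_smul, pow_succ']
      rw [hrec k (by omega), ih k (by omega) (by omega) (k + 1 + M + 1) (by omega),
        sum_congr (s₁ := range (k + 1)) rfl fun j hj => by rw [hA j (mem_range.1 hj)],
        sum_range_succ', sum_range_succ' _ (k + 1 + M)]
      simp only [Pinv_succ_succ, add_smul, sum_add_distrib, Pinv_zero_right, sum_smul, smul_sum,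
        mul_smul]
      rw [sum_comm]
      abel

lemma Gmat_mulVec_zero (p : ℕ) (v : Fin (p + 2) → ℝ) :
    (Gmat (p + 2)).mulVec v 0 = (v 0 + v (Fin.last (p + 1))) / 2 := by
  have h : (Gmat (p + 2)) 0 = Pi.single 0 (1 / 2) + Pi.single (Fin.last (p + 1)) (1 / 2) := by
    ext j
    simp only [Gmat, Matrix.of_apply, Pi.add_apply, Pi.single_apply]
    grind
  rw [Matrix.mulVec, h, add_dotProduct, single_dotProduct, single_dotProduct]
  ring

lemma Gmat_mulVec_succ (p : ℕ) (v : Fin (p + 2) → ℝ) (i : Fin (p + 1)) :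
    (Gmat (p + 2)).mulVec v i.succ = (v i.succ - v i.castSucc) / 2 := by
  have h : (Gmat (p + 2)) i.succ =
      Pi.single i.succ (1 / 2) + Pi.single i.castSucc (-(1 / 2)) := by
    ext j
    simp only [Gmat, Matrix.of_apply, Pi.add_apply, Pi.single_apply]
    grind
  rw [Matrix.mulVec, h, add_dotProduct, single_dotProduct, single_dotProduct]
  ring

lemma pow_mulVec_const (p : ℕ) (c : ℝ) (k : ℕ) (hk : k ≤ p + 2) (i : Fin (p + 2)) :
    (((-2 : ℝ) • Gmat (p + 2) + 1) ^ k).mulVec (fun _ => c) i =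
      if (i : ℕ) < k then -c else c := by
  induction k generalizing i with
  | zero => simp
  | succ k ih =>
    rw [pow_succ', ← Matrix.mulVec_mulVec, Matrix.add_mulVec, Matrix.one_mulVec,
      Matrix.smul_mulVec, Pi.add_apply, Pi.smul_apply, smul_eq_mul]
    refine Fin.cases ?_ (fun i => ?_) i
    · rw [Gmat_mulVec_zero, ih (by omega), ih (by omega)]
      simp only [Fin.val_zero, Fin.val_last]
      grind
    · rw [Gmat_mulVec_succ, ih (by omega), ih (by omega)]
      simp only [Fin.val_succ, Fin.val_castSucc]
      grind

/-- Under H-invariance, `G y_{N−1} = y₀ / N` where `N = p + 2`. -/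
lemma Gmat_mulVec_last_iterate (p : ℕ) (H : ℕ → ℕ → ℝ)
    (hinv : ∀ m, 1 ≤ m → m ≤ p + 1 →
      Pinv H (p + 1) m = 1 / ((p + 2 : ℕ) : ℝ) * (Nat.choose (p + 2) (m + 1) : ℝ))
    (y : ℕ → Fin (p + 2) → ℝ) (c : ℝ) (hy : y 0 = fun _ => c)
    (hrec : ∀ k < p + 1, y (k + 1) = y k +
      ∑ j ∈ range (k + 1), H (k + 1) (j + 1) • ((-2 : ℝ) • Gmat (p + 2)).mulVec (y j)) :
    (Gmat (p + 2)).mulVec (y (p + 1)) = (1 / ((p + 2 : ℕ) : ℝ)) • y 0 := by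
  set A := (-2 : ℝ) • Gmat (p + 2) with hA
  have hP : ∀ m ∈ range (p + 2),
      Pinv H (p + 1) m = 1 / ((p + 2 : ℕ) : ℝ) * (Nat.choose (p + 2) (m + 1) : ℝ) := by
    intro m hm
    rcases Nat.eq_zero_or_pos m with rfl | hm'
    · rw [Pinv_zero_right, zero_add, Nat.choose_one_right, one_div_mul_cancel]
      positivity
    · exact hinv m hm' (by rw [mem_range] at hm; omega)
  have hyA : A.mulVec (y (p + 1)) =
      (1 / ((p + 2 : ℕ) : ℝ)) • (((A + 1) ^ (p + 2)).mulVec (y 0) - y 0) := by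
    rw [eq_sum_Pinv_smul_pow_mulVec H A y (p + 1) hrec (p + 1) le_rfl (p + 2) (by omega),
      sum_congr rfl fun m hm => by rw [hP m hm], Matrix.mulVec_sum,
      (Commute.one_right A).add_pow, sum_range_succ' _ (p + 2),
      Matrix.add_mulVec, Matrix.sum_mulVec]
    simp only [Matrix.mulVec_smul, Matrix.mulVec_mulVec, ← pow_succ', one_pow, mul_one, pow_zero,
      Nat.choose_zero_right, Nat.cast_one, Matrix.one_mulVec, add_sub_cancel_right, smul_sum,
      mul_smul]
    refine sum_congr rfl fun m _ => ?_
    rw [← nsmul_eq_mul', Nat.cast_smul_eq_nsmul, Matrix.smul_mulVec]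
  have hpow : ((A + 1) ^ (p + 2)).mulVec (y 0) = -y 0 := by
    ext i
    rw [hy, hA, pow_mulVec_const p c (p + 2) le_rfl, if_pos i.2]
    rfl
  rw [hpow, hA, Matrix.smul_mulVec] at hyA
  ext i
  have := congrFun hyA i
  simp only [Pi.smul_apply, Pi.sub_apply, Pi.neg_apply, smul_eq_mul] at this ⊢
  linarith

/-- The matrix with columns `G y_k` is upper triangular with explicit diagonal. -/
lemma Gmat_mulVec_iterate_triangular (p : ℕ) (H : ℕ → ℕ → ℝ)
    (y : ℕ → Fin (p + 2) → ℝ) (c : ℝ) (hy : y 0 = fun _ => c)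
    (hrec : ∀ k < p + 1, y (k + 1) = y k +
      ∑ j ∈ range (k + 1), H (k + 1) (j + 1) • ((-2 : ℝ) • Gmat (p + 2)).mulVec (y j))
    (k : ℕ) (hk : k ≤ p + 1) (i : Fin (p + 2)) :
    (k < i → (Gmat (p + 2)).mulVec (y k) i = 0) ∧
      ((i : ℕ) = k →
        (Gmat (p + 2)).mulVec (y k) i = c * ∏ j ∈ range k, H (j + 1) (j + 1)) := by
  induction k using Nat.strong_induction_on generalizing i with
  | _ k ih =>
    cases k with
    | zero =>
      refine Fin.cases ?_ (fun i => ?_) i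
      · simp [Gmat_mulVec_zero, hy]
      · simp [Gmat_mulVec_succ, hy]
    | succ k =>
      refine Fin.cases (by simp) (fun i => ?_) i
      have hstep : (Gmat (p + 2)).mulVec (y (k + 1)) i.succ =
          (Gmat (p + 2)).mulVec (y k) i.succ - ∑ j ∈ range (k + 1), H (k + 1) (j + 1) *
            ((Gmat (p + 2)).mulVec (y j) i.succ - (Gmat (p + 2)).mulVec (y j) i.castSucc) := by
        rw [hrec k (by omega), Matrix.mulVec_add, Matrix.mulVec_sum, Pi.add_apply,
          Finset.sum_apply, sub_eq_add_neg, ← sum_neg_distrib]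
        congr 1
        refine sum_congr rfl fun j _ => ?_
        rw [Matrix.mulVec_smul, Matrix.smul_mulVec, Matrix.mulVec_smul, Pi.smul_apply,
          Pi.smul_apply, Gmat_mulVec_succ, smul_eq_mul, smul_eq_mul]
        ring
      have hzero : ∀ j ≤ k, ∀ i : Fin (p + 2), j < (i : ℕ) →
          (Gmat (p + 2)).mulVec (y j) i = 0 :=
        fun j hj i => (ih j (by omega) (by omega) i).1
      rw [hstep, sum_range_succ, Fin.val_succ]
      constructor
      · intro hi
        rw [hzero k le_rfl _ (by simp; omega), hzero k le_rfl _ (by simp; omega),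
          sum_eq_zero fun j hj => ?_]
        · ring
        · rw [mem_range] at hj
          rw [hzero j (by omega) _ (by simp; omega), hzero j (by omega) _ (by simp; omega)]
          ring
      · intro hi
        rw [hzero k le_rfl i.succ (by simp; omega), sum_eq_zero fun j hj => ?_,
          (ih k (by omega) (by omega) i.castSucc).2 (by simp; omega), prod_range_succ]
        · ring
        · rw [mem_range] at hj
          rw [hzero j (by omega) _ (by simp; omega), hzero j (by omega) _ (by simp; omega)]
          ring

lemma prod_range_prod_range_eq_prod_pow (f : ℕ → ℝ) (n : ℕ) :
    ∏ i ∈ range (n + 1), ∏ j ∈ range i, f (j + 1) = ∏ j ∈ Icc 1 n, f j ^ (n + 1 - j) := by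
  induction n with
  | zero => simp
  | succ n ih =>
    rw [prod_range_succ, ih, prod_range_succ, prod_Icc_succ_top (by omega),
      Nat.add_sub_cancel_left, pow_one, ← mul_assoc, range_eq_Ico,
      prod_Ico_add' f 0 n 1, zero_add, Ico_add_one_right_eq_Icc, ← prod_mul_distrib]
    congr 1
    refine prod_congr rfl fun j hj => ?_
    rw [mem_Icc] at hj
    rw [← pow_succ]
    congr 1
    omega

open Matrix in
/-- **Derivative of the determinant at the worst-case Gram matrix (Lemma 6.4).**
Under H-invariance, for any symmetric `δ ∈ ℝ^{(N+1)×(N+1)}` with `δ_{N+1,N+1} = 0`, the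
function `t ↦ det(G₀ + t·δ)` is differentiable at `t = 0` with derivative
`(1/N^{N−2})·(∏_{j=1}^{N−1} h_{j,j}^{2(N−j)})·(δ_{N,N} − (2/N)·δ_{N,N+1})`. -/
theorem gram_determinant_derivative (N : ℕ) (hN : 2 ≤ N) (H : ℕ → ℕ → ℝ)
    (hinv : ∀ m, 1 ≤ m → m ≤ N - 1 →
      Pinv H (N - 1) m = 1 / (N : ℝ) * (Nat.choose N (m + 1) : ℝ))
    (T : (Fin N → ℝ) → (Fin N → ℝ)) (hT : ∀ v, T v = v - (2 : ℝ) • (Gmat N).mulVec v)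
    (y0 : Fin N → ℝ) (hy0 : y0 = fun _ => -(1 / Real.sqrt N))
    (y : ℕ → Fin N → ℝ) (hyinit : y 0 = y0)
    (hrec : ∀ k, k < N - 1 →
      y (k + 1) = y k - ∑ j ∈ Finset.range (k + 1), H (k + 1) (j + 1) • (y j - T (y j)))
    (g : ℕ → Fin N → ℝ) (hg : ∀ i, 1 ≤ i → i ≤ N → g i = (Gmat N).mulVec (y (i - 1)))
    (G0 : Matrix (Fin (N + 1)) (Fin (N + 1)) ℝ)
    (hG0 : ∀ a b : Fin (N + 1),
      G0 a b = (if (a : ℕ) < N then g ((a : ℕ) + 1) else y0) ⬝ᵥ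
               (if (b : ℕ) < N then g ((b : ℕ) + 1) else y0))
    (δ : Matrix (Fin (N + 1)) (Fin (N + 1)) ℝ) (hδsym : δ.IsSymm)
    (hδcorner : δ ⟨N, by omega⟩ ⟨N, by omega⟩ = 0) :
    HasDerivAt (fun t : ℝ => (G0 + t • δ).det)
      (1 / (N : ℝ) ^ (N - 2) * (∏ j ∈ Finset.Icc 1 (N - 1), H j j ^ (2 * (N - j))) *
        (δ ⟨N - 1, by omega⟩ ⟨N - 1, by omega⟩
          - 2 / (N : ℝ) * δ ⟨N - 1, by omega⟩ ⟨N, by omega⟩))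
      0 := by
  obtain ⟨p, rfl⟩ := Nat.exists_eq_add_of_le' hN
  have hy : y 0 = fun _ => -(1 / Real.sqrt (p + 2 : ℕ)) := hyinit.trans hy0
  replace hrec : ∀ k < p + 1, y (k + 1) = y k +
      ∑ j ∈ range (k + 1), H (k + 1) (j + 1) • ((-2 : ℝ) • Gmat (p + 2)).mulVec (y j) := by
    intro k hk
    rw [hrec k hk, sub_eq_add_neg, ← sum_neg_distrib]
    congr 1
    refine sum_congr rfl fun j _ => ?_
    rw [hT, sub_sub_cancel, smul_mulVec, neg_smul, smul_neg]
  replace hg : ∀ i : Fin (p + 2), g (i + 1) = (Gmat (p + 2)).mulVec (y i) :=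
    fun i => hg _ (by omega) (by omega)
  have htri := Gmat_mulVec_iterate_triangular p H y _ hy hrec
  have hlast := Gmat_mulVec_last_iterate p H hinv y _ hy hrec
  have hN0 : ((p + 2 : ℕ) : ℝ) ≠ 0 := by positivity
  let v : Fin (p + 3) → Fin (p + 2) → ℝ := fun a => if (a : ℕ) < p + 2 then g (a + 1) else y0
  have hv : ∀ a : Fin (p + 2), v a.castSucc = (Gmat (p + 2)).mulVec (y a) := fun a => by
    simp [v, hg]
  have hvlast : v (Fin.last (p + 2)) = y 0 := by simp [v, hyinit]
  let W : Matrix (Fin (p + 3)) (Fin (p + 3)) ℝ :=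
    of (Fin.snoc (fun i a => v a i) (Pi.single (Fin.last (p + 2)) 1) :
      Fin (p + 3) → Fin (p + 3) → ℝ)
  have hW : ∀ (i : Fin (p + 2)) a, W i.castSucc a = v a i := fun i a => by
    simp [W]
  have hWlast : ∀ a, W (Fin.last (p + 2)) a = Pi.single (M := fun _ => ℝ) (Fin.last (p + 2)) 1 a :=
    fun a => by simp [W]
  let c : Fin (p + 3) → ℝ := Pi.single (Fin.last (p + 1)).castSucc 1 +
    Pi.single (Fin.last (p + 2)) (-((p + 2 : ℕ) : ℝ))⁻¹
  have hc : W *ᵥ c = Pi.single (Fin.last (p + 2)) (-((p + 2 : ℕ) : ℝ))⁻¹ := by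
    ext i
    simp only [c, mulVec_add, mulVec_single, Pi.add_apply, Pi.smul_apply, op_smul_eq_smul,
      smul_eq_mul, one_mul, col_apply]
    refine Fin.lastCases ?_ (fun i => ?_) i
    · rw [hWlast, hWlast]
      simp
    · rw [hW, hW, hv, hvlast, Fin.val_last, hlast, Pi.single_eq_of_ne (Fin.castSucc_ne_last i),
        Pi.smul_apply, smul_eq_mul, inv_neg]
      ring
  have hG : G0 = Wᵀ * diagonal (Fin.snoc (fun _ => 1) 0) * W := by
    ext a b
    rw [hG0, mul_apply, Fin.sum_univ_castSucc]
    simp [mul_diagonal, hW, dotProduct, v]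
  have hupper : W.IsUpperTriangular := by
    intro i a
    refine Fin.lastCases (fun h => ?_) (fun i h => ?_) i
    · rw [hWlast, Pi.single_eq_of_ne (show a ≠ Fin.last (p + 2) from ne_of_lt h)]
    · obtain ⟨a, rfl⟩ := Fin.exists_castSucc_eq.2 (h.trans (Fin.castSucc_lt_last i)).ne
      rw [hW, hv]
      exact (htri a (by omega) i).1 h
  have hdet : W.det = (-(1 / Real.sqrt (p + 2 : ℕ))) ^ (p + 2) *
      ∏ j ∈ Icc 1 (p + 1), H j j ^ (p + 2 - j) := by
    rw [det_of_isUpperTriangular hupper, Fin.prod_univ_castSucc, hWlast, Pi.single_eq_same, mul_one,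
      ← prod_range_prod_range_eq_prod_pow (fun j => H j j), ← Fin.prod_univ_eq_prod_range
        (fun i => ∏ j ∈ range i, H (j + 1) (j + 1)), ← Fin.prod_const, ← prod_mul_distrib]
    refine prod_congr rfl fun i _ => ?_
    rw [hW, hv]
    exact (htri i (by omega) i).2 rfl
  have hsq : (-((p + 2 : ℕ) : ℝ) * W.det) ^ 2 = 1 / ((p + 2 : ℕ) : ℝ) ^ p *
      ∏ j ∈ Icc 1 (p + 1), H j j ^ (2 * (p + 2 - j)) := by
    have hprod : ∏ j ∈ Icc 1 (p + 1), H j j ^ (2 * (p + 2 - j)) =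
        (∏ j ∈ Icc 1 (p + 1), H j j ^ (p + 2 - j)) ^ 2 := by
      rw [← prod_pow]
      exact prod_congr rfl fun j _ => by rw [mul_comm, pow_mul]
    rw [hdet, hprod, mul_pow, mul_pow, ← pow_mul, mul_comm (p + 2) 2, pow_mul, neg_sq, neg_sq,
      div_pow, Real.sq_sqrt (Nat.cast_nonneg _), one_pow, _root_.one_div_pow, pow_add _ p 2]
    field_simp
  have hderiv := hasDerivAt_det_add_smul G0 δ
  rw [hG, adjugate_transpose_mul_diagonal_mul W c _ (neg_ne_zero.2 hN0) hc, ← hG, hsq] at hderiv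
  convert! hderiv using 1
  have hδ : δ (Fin.last (p + 2)) (Fin.last (p + 2)) = 0 := hδcorner
  have hδ' : δ (Fin.last (p + 2)) (Fin.last (p + 1)).castSucc =
    δ (Fin.last (p + 1)).castSucc (Fin.last (p + 2)) := hδsym.apply _ _
  rw [smul_mul, trace_smul, vecMulVec_mul, trace_vecMulVec, smul_eq_mul]
  congr 1
  change δ (Fin.last (p + 1)).castSucc (Fin.last (p + 1)).castSucc -
    2 / ((p + 2 : ℕ) : ℝ) * δ (Fin.last (p + 1)).castSucc (Fin.last (p + 2)) = _
  simp only [c, add_vecMul, add_dotProduct, single_dotProduct, single_vecMul, Pi.add_apply,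
    Pi.smul_apply, smul_eq_mul, row_apply, hδ, hδ', inv_neg]
  ring
end

section
/- Let N ≥ 2 and let H be an H-matrix satisfying the H-invariance conditions P(N−1,m;H) = (1/N)·C(N,m+1) for m = 1,…,N−1. In ℝ^{N+1} with standard basis e₁,…,e_{N+1}, set g_i = e_i for i = 1,…,N, y₀ = e_{N+1}, y_i = y_{i−1} − Σ_{j=1}^{i} 2h_{i,j}·e_j for i = 1,…,N−1, and x_i = y_{i−1} − e_i for i = 1,…,N. Define the symmetric (N+1)×(N+1) matrices A_{i,j} = (1/2)·((x_i − x_j)(e_i − e_j)ᵀ + (e_i − e_j)(x_i − x_j)ᵀ) for 1 ≤ j < i ≤ N, B_i = (1/2)·(x_i e_iᵀ + e_i x_iᵀ) for i = 1,…,N, C = e_{N+1}e_{N+1}ᵀ, D with D_{N,N} = 1, D_{N,N+1} = D_{N+1,N} = −1/N and zero elsewhere, and E with E_{N,N} = 1 and zero elsewhere. Then, for real numbers a_{i,j} (1 ≤ j < i ≤ N), b₁,…,b_N, c, d, e, the identity Σ_{i=2}^{N} Σ_{j=1}^{i−1} a_{i,j}·A_{i,j} + Σ_{i=1}^{N} b_i·B_i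 + c·C + d·D + e·E = 0 holds if and only if d = e, c = 0, b_i = 0 for i = 1,…,N−1, b_N = 2d/N, and a_{i,j} = b_N·λ*_{i,j}(H) for all 1 ≤ j < i ≤ N. -/
open Finset

/-- `ebasis N j` is the `j`-th standard basis vector `e_j` of `ℝ^{N+1}` (`1 ≤ j ≤ N+1`). -/
noncomputable def ebasis (N j : ℕ) : Fin (N + 1) → ℝ := fun a => if (a : ℕ) + 1 = j then 1 else 0

theorem sum_ite_and_eq {ι : Type*} [DecidableEq ι] (s : Finset ι) (c : Prop) [Decidable c]
    (a : ι) (v : ℝ) :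
    ∑ x ∈ s, (if c ∧ a = x then v else 0) = if c ∧ a ∈ s then v else 0 := by
  by_cases hc : c <;> simp [hc]

section IndexSequences

variable (H : ℕ → ℕ → ℝ) (k : ℕ)

theorem sum_Qinv_eq_sum_ite (s : Finset ℕ) (m : ℕ) :
    ∑ j ∈ s, Qinv H k (m + 1) j =
      ∑ f : Fin (m + 1) → Fin (k + 1) × Fin (k + 1),
        if (∀ r, 1 ≤ ((f r).2 : ℕ) ∧ ((f r).2 : ℕ) ≤ ((f r).1 : ℕ)) ∧
            (∀ r : Fin m, ((f r.castSucc).1 : ℕ) < ((f r.succ).2 : ℕ)) ∧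
            ((f 0).2 : ℕ) ∈ s then
          ∏ r, H ((f r).1 : ℕ) ((f r).2 : ℕ)
        else 0 := by
  simp only [Qinv]
  rw [Finset.sum_comm]
  refine Finset.sum_congr rfl fun f _ => ?_
  simp only [← and_assoc]
  convert sum_ite_and_eq s _ _ _

theorem sum_Qinv_eq_Pinv (m : ℕ) :
    ∑ j ∈ Finset.Icc 1 k, Qinv H k (m + 1) j = Pinv H k (m + 1) := by
  rw [sum_Qinv_eq_sum_ite, Pinv]
  refine Finset.sum_congr rfl fun f _ => if_congr ?_ rfl rfl
  refine and_congr_right fun h => and_iff_left ?_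
  have := (f 0).2.isLt
  exact Finset.mem_Icc.2 ⟨(h 0).1, by omega⟩

theorem sum_Icc_eq_sum_fin (p : ℕ) (g : ℕ → ℝ) :
    ∑ l ∈ Finset.Icc p k, g l = ∑ l : Fin (k + 1), if p ≤ (l : ℕ) then g l else 0 := by
  rw [Fin.sum_univ_eq_sum_range (fun l => if p ≤ l then g l else 0), ← Finset.sum_filter]
  refine Finset.sum_congr ?_ fun _ _ => rfl
  ext l
  simp only [Finset.mem_Icc, Finset.mem_filter, Finset.mem_range]
  omega

theorem Qinv_one {p : ℕ} (hp : 1 ≤ p) :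
    Qinv H k 1 p = ∑ l ∈ Finset.Icc p k, H l p := by
  rw [sum_Icc_eq_sum_fin, Qinv,
    Fintype.sum_equiv (Equiv.funUnique (Fin 1) (Fin (k + 1) × Fin (k + 1))) _
      (fun c => if 1 ≤ (c.2 : ℕ) ∧ (c.2 : ℕ) ≤ (c.1 : ℕ) ∧ (c.2 : ℕ) = p then
        H c.1 c.2 else 0) (fun f => by simp [Fin.forall_fin_one, and_assoc]),
    Fintype.sum_prod_type]
  refine Finset.sum_congr rfl fun l _ => ?_
  split_ifs with h
  · have := l.isLt
    rw [Finset.sum_eq_single (⟨p, by omega⟩ : Fin (k + 1))]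
    · simp [hp, h]
    · intro j _ hj
      exact if_neg fun hc => hj (Fin.ext hc.2.2)
    · simp
  · exact Finset.sum_eq_zero fun j _ => if_neg <| by
      rintro ⟨-, h1, rfl⟩
      exact h h1

theorem Qinv_add_two {p : ℕ} (hp : 1 ≤ p) (m : ℕ) :
    Qinv H k (m + 2) p =
      ∑ l ∈ Finset.Icc p k, H l p * ∑ j ∈ Finset.Ioc l k, Qinv H k (m + 1) j := by
  rw [sum_Icc_eq_sum_fin, Qinv,
    ← (Fin.consEquiv fun _ : Fin (m + 2) => Fin (k + 1) × Fin (k + 1)).sum_comp,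
    Fintype.sum_prod_type, Fintype.sum_prod_type]
  refine Finset.sum_congr rfl fun l _ => ?_
  have hl := l.isLt
  split_ifs with h
  · rw [sum_Qinv_eq_sum_ite, Finset.sum_eq_single (⟨p, by omega⟩ : Fin (k + 1))]
    · rw [Finset.mul_sum]
      refine Finset.sum_congr rfl fun f _ => ?_
      rw [mul_ite, mul_zero]
      refine if_congr ?_ ?_ rfl
      · have := (f 0).2.isLt
        simp only [Fin.consEquiv_apply, Finset.mem_Ioc]
        constructor
        · rintro ⟨h1, h2, -⟩
          have h3 := h2 0
          simp only [Fin.castSucc_zero, Fin.cons_zero, Fin.cons_succ] at h3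
          exact ⟨fun r => by simpa using h1 r.succ, fun r => by simpa using h2 r.succ, h3, by omega⟩
        · rintro ⟨h1, h2, h3, -⟩
          exact ⟨Fin.cases ⟨hp, h⟩ h1, Fin.cases h3 h2, rfl⟩
      · rw [Fin.prod_univ_succ]
        simp [Fin.consEquiv_apply]
    · intro j _ hj
      refine Finset.sum_eq_zero fun f _ => if_neg fun hc => hj (Fin.ext ?_)
      simpa using hc.2.2
    · simp
  · refine Finset.sum_eq_zero fun j _ => Finset.sum_eq_zero fun f _ => if_neg fun hc => h ?_
    have h1 := (hc.1 0).2
    have h2 := hc.2.2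
    simp only [Fin.consEquiv_apply, Fin.cons_zero] at h1 h2
    omega

theorem Qinv_eq_zero {p : ℕ} (hp : 1 ≤ p) (m : ℕ) (h : k < p + m) : Qinv H k (m + 1) p = 0 := by
  induction m generalizing p with
  | zero => rw [Qinv_one H k hp, Finset.Icc_eq_empty (by omega), Finset.sum_empty]
  | succ m ih =>
    rw [Qinv_add_two H k hp]
    refine Finset.sum_eq_zero fun l hl => mul_eq_zero_of_right _ <| Finset.sum_eq_zero fun j hj => ?_
    rw [Finset.mem_Icc] at hl
    rw [Finset.mem_Ioc] at hj
    exact ih (by omega) (by omega)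

end IndexSequences

section BinomialForm

open Polynomial

/-- The bilinear form on `ℝ[X]` with `⟨X^l, X^m⟩ = (-1)^(l+m) * C(l+m, m)`. -/
noncomputable def binomialForm : ℝ[X] →ₗ[ℝ] ℝ[X] →ₗ[ℝ] ℝ :=
  (Polynomial.basisMonomials ℝ).constr ℝ fun l =>
    (Polynomial.basisMonomials ℝ).constr ℝ fun m => (-1 : ℝ) ^ (l + m) * (Nat.choose (l + m) m : ℝ)

theorem binomialForm_X_pow (l m : ℕ) :
    binomialForm (X ^ l) (X ^ m) = (-1 : ℝ) ^ (l + m) * (Nat.choose (l + m) m : ℝ) := by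
  have h : ∀ n, (X ^ n : ℝ[X]) = Polynomial.basisMonomials ℝ n := fun n => by
    simp [Polynomial.coe_basisMonomials, Polynomial.monomial_one_right_eq_X_pow]
  rw [h, h, binomialForm, Module.Basis.constr_basis, Module.Basis.constr_basis]

theorem binomialForm_comm (f g : ℝ[X]) : binomialForm f g = binomialForm g f := by
  have : binomialForm = binomialForm.flip := by
    refine (Polynomial.basisMonomials ℝ).ext fun l => (Polynomial.basisMonomials ℝ).ext fun m => ?_
    simp only [Polynomial.coe_basisMonomials, Polynomial.monomial_one_right_eq_X_pow,
      LinearMap.flip_apply, binomialForm_X_pow]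
    rw [add_comm m l, Nat.choose_symm_add]
  exact congrArg (fun φ => φ f g) this

theorem binomialForm_one_right (f : ℝ[X]) : binomialForm f 1 = f.eval (-1) := by
  induction f using Polynomial.induction_on' with
  | add p q hp hq => simp [hp, hq]
  | monomial n a =>
    have := binomialForm_X_pow n 0
    rw [← Polynomial.C_mul_X_pow_eq_monomial, ← Polynomial.smul_eq_C_mul]
    simp_all

theorem binomialForm_X_mul_X_mul (f g : ℝ[X]) :
    binomialForm (X * f) (X * g) = -binomialForm f (X * g) - binomialForm (X * f) g := by
  induction f using Polynomial.induction_on' with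
  | add p q hp hq => simp only [mul_add, map_add, LinearMap.add_apply, hp, hq]; ring
  | monomial l a =>
    induction g using Polynomial.induction_on' with
    | add p q hp hq => simp only [mul_add, map_add, hp, hq]; ring
    | monomial m b =>
      simp only [← Polynomial.C_mul_X_pow_eq_monomial, ← Polynomial.smul_eq_C_mul,
        mul_smul_comm, map_smul, LinearMap.smul_apply, ← pow_succ', binomialForm_X_pow]
      have h1 : l + 1 + (m + 1) = (l + m + 1) + 1 := by ring
      have h2 : l + (m + 1) = l + m + 1 := by ring
      have h3 : l + 1 + m = l + m + 1 := by ring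
      rw [h1, h2, h3, Nat.choose_succ_succ]
      push_cast
      simp only [smul_eq_mul]
      ring

theorem binomialForm_X_mul_one (f : ℝ[X]) : binomialForm (X * f) 1 = -binomialForm f 1 := by
  simp [binomialForm_one_right]

theorem binomialForm_one_add_X_pow_mul (n m : ℕ) (h : m < n) (f : ℝ[X]) :
    binomialForm ((1 + X) ^ n * f) (X ^ m) = 0 := by
  induction m generalizing n f with
  | zero => simp [binomialForm_one_right, h.ne']
  | succ m ih =>
    obtain ⟨n, rfl⟩ : ∃ k, n = k + 1 := ⟨n - 1, by omega⟩
    have h1 := binomialForm_X_mul_X_mul ((1 + X) ^ n * f) (X ^ m)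
    have h2 := ih n (by omega) (X * f)
    rw [mul_left_comm] at h2
    rw [h2, ← pow_succ'] at h1
    rw [show (1 + X) ^ (n + 1) * f = (1 + X) ^ n * f + X * ((1 + X) ^ n * f) by ring, map_add,
      LinearMap.add_apply, h1]
    ring

theorem binomialForm_eq_zero_of_X_mul_eq {n m : ℕ} {c : ℝ} (hm : 1 ≤ m) (hmn : m < n)
    {T : ℝ[X]} (hT : X * T = c • ((1 + X) ^ n - 1)) : binomialForm T (X ^ m) = 0 := by
  obtain ⟨m, rfl⟩ : ∃ k, m = k + 1 := ⟨m - 1, by omega⟩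
  have h1 := binomialForm_X_mul_X_mul T (X ^ m)
  have h2 := binomialForm_one_add_X_pow_mul n m (by omega) 1
  have h3 := binomialForm_one_add_X_pow_mul n (m + 1) hmn 1
  have h4 : binomialForm 1 (X ^ m) = -binomialForm 1 (X ^ (m + 1)) := by
    simp [binomialForm_comm 1, binomialForm_one_right, pow_succ]
  rw [mul_one] at h2 h3
  rw [← pow_succ', hT] at h1
  simp only [map_smul, map_sub, LinearMap.smul_apply, LinearMap.sub_apply, h2, h3, h4,
    smul_eq_mul] at h1
  linarith

theorem binomialForm_one_of_X_mul_eq {n : ℕ} (hn : n ≠ 0) {c : ℝ}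
    {T : ℝ[X]} (hT : X * T = c • ((1 + X) ^ n - 1)) : binomialForm T 1 = c := by
  have h := binomialForm_X_mul_one T
  rw [hT, map_smul, LinearMap.smul_apply, binomialForm_one_right] at h
  simp [hn] at h
  exact h.symm

end BinomialForm

section CertificatePolynomials

open Polynomial

/-- The generating polynomial `∑ m, Q(N-1,m,j;H) X^m` for `j < N`, and `1` for `j = N`. -/
noncomputable def certPoly (N : ℕ) (H : ℕ → ℕ → ℝ) (j : ℕ) : ℝ[X] :=
  if j = N then 1 else ∑ m ∈ Finset.Icc 1 (N - j), Qinv H (N - 1) m j • X ^ m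

/-- The quotient of `certPoly N H p` by `X` for `p < N`, and `0` for `p = N`. -/
noncomputable def certQuot (N : ℕ) (H : ℕ → ℕ → ℝ) (p : ℕ) : ℝ[X] :=
  ∑ l ∈ Finset.Ico p N, H l p • ∑ j ∈ Finset.Ioc l N, certPoly N H j

variable {N : ℕ} {H : ℕ → ℕ → ℝ}

theorem certPoly_self : certPoly N H N = 1 := if_pos rfl

theorem certQuot_self : certQuot N H N = 0 := by simp [certQuot]

theorem coeff_certPoly_zero {j : ℕ} (hj : j < N) : (certPoly N H j).coeff 0 = 0 := by
  rw [certPoly, if_neg hj.ne, Polynomial.finsetSum_coeff]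
  refine Finset.sum_eq_zero fun m hm => ?_
  rw [Finset.mem_Icc] at hm
  rw [Polynomial.coeff_smul, Polynomial.coeff_X_pow, if_neg (by omega), smul_zero]

theorem coeff_certPoly_succ {j : ℕ} (hj1 : 1 ≤ j) (hj : j < N) (m : ℕ) :
    (certPoly N H j).coeff (m + 1) = Qinv H (N - 1) (m + 1) j := by
  simp only [certPoly, if_neg hj.ne, Polynomial.finsetSum_coeff, Polynomial.coeff_smul,
    Polynomial.coeff_X_pow, smul_eq_mul, mul_ite, mul_one, mul_zero, Finset.sum_ite_eq,
    Finset.mem_Icc]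
  split_ifs with h
  · rfl
  · exact (Qinv_eq_zero H (N - 1) hj1 m (by omega)).symm

theorem coeff_sum_Ioc_certPoly_zero {l : ℕ} (hl : l < N) :
    (∑ j ∈ Finset.Ioc l N, certPoly N H j).coeff 0 = 1 := by
  rw [Polynomial.finsetSum_coeff, Finset.sum_eq_single N]
  · simp [certPoly_self]
  · intro j hj hjN
    rw [Finset.mem_Ioc] at hj
    exact coeff_certPoly_zero (by omega)
  · intro h
    exact absurd (Finset.mem_Ioc.2 ⟨hl, le_rfl⟩) h

theorem coeff_sum_Ioc_certPoly_succ {l : ℕ} (hl : l < N) (m : ℕ) :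
    (∑ j ∈ Finset.Ioc l N, certPoly N H j).coeff (m + 1) =
      ∑ j ∈ Finset.Ioc l (N - 1), Qinv H (N - 1) (m + 1) j := by
  obtain ⟨n, rfl⟩ : ∃ n, N = n + 1 := ⟨N - 1, by omega⟩
  rw [Polynomial.finsetSum_coeff, Finset.sum_Ioc_succ_top (by omega), certPoly_self,
    Polynomial.coeff_one, if_neg (by omega), add_zero]
  refine Finset.sum_congr rfl fun j hj => ?_
  rw [Finset.mem_Ioc] at hj
  exact coeff_certPoly_succ (by omega) (by omega) m

theorem certPoly_eq_X_mul_certQuot {p : ℕ} (hp1 : 1 ≤ p) (hp : p < N) :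
    certPoly N H p = X * certQuot N H p := by
  have hI : Finset.Ico p N = Finset.Icc p (N - 1) := by
    ext l
    simp only [Finset.mem_Ico, Finset.mem_Icc]
    omega
  ext m
  rcases m with _ | _ | m
  · rw [coeff_certPoly_zero hp, Polynomial.coeff_X_mul_zero]
  · rw [coeff_certPoly_succ hp1 hp, Polynomial.coeff_X_mul, certQuot, Polynomial.finsetSum_coeff,
      Qinv_one H _ hp1, hI]
    refine Finset.sum_congr rfl fun l hl => ?_
    rw [Finset.mem_Icc] at hl
    rw [Polynomial.coeff_smul, coeff_sum_Ioc_certPoly_zero (by omega), smul_eq_mul, mul_one]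
  · rw [coeff_certPoly_succ hp1 hp, Polynomial.coeff_X_mul, certQuot, Polynomial.finsetSum_coeff,
      Qinv_add_two H _ hp1, hI]
    refine Finset.sum_congr rfl fun l hl => ?_
    rw [Finset.mem_Icc] at hl
    rw [Polynomial.coeff_smul, coeff_sum_Ioc_certPoly_succ (by omega), smul_eq_mul]

theorem X_mul_sum_certPoly (hN : 1 ≤ N)
    (hinv : ∀ m, 1 ≤ m → m ≤ N - 1 →
      Pinv H (N - 1) m = 1 / (N : ℝ) * (Nat.choose N (m + 1) : ℝ)) :
    X * ∑ j ∈ Finset.Icc 1 N, certPoly N H j = (1 / (N : ℝ)) • ((1 + X) ^ N - 1) := by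
  have hN0 : (N : ℝ) ≠ 0 := by positivity
  have hI : ∀ n, Finset.Icc 1 n = Finset.Ioc 0 n := fun n => by
    ext
    simp only [Finset.mem_Icc, Finset.mem_Ioc]
    omega
  rw [hI]
  ext m
  rcases m with _ | _ | m
  · simp [Polynomial.coeff_zero_eq_eval_zero]
  · rw [Polynomial.coeff_X_mul, coeff_sum_Ioc_certPoly_zero (by omega), Polynomial.coeff_smul,
      Polynomial.coeff_sub, Polynomial.coeff_one_add_X_pow]
    simp [Polynomial.coeff_one, hN0]
  · rw [Polynomial.coeff_X_mul, coeff_sum_Ioc_certPoly_succ (by omega), ← hI, sum_Qinv_eq_Pinv,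
      Polynomial.coeff_smul, Polynomial.coeff_sub, Polynomial.coeff_one_add_X_pow]
    by_cases hm : m + 1 ≤ N - 1
    · rw [hinv _ (by omega) hm]
      simp [Polynomial.coeff_one]
    · rw [← sum_Qinv_eq_Pinv, Finset.sum_eq_zero, Nat.choose_eq_zero_of_lt (by omega)]
      · simp [Polynomial.coeff_one]
      · intro j hj
        rw [Finset.mem_Icc] at hj
        exact Qinv_eq_zero H _ hj.1 _ (by omega)

theorem binomialForm_certPoly_sum {q : ℕ} (hq1 : 1 ≤ q) (hq : q ≤ N)
    (hinv : ∀ m, 1 ≤ m → m ≤ N - 1 →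
      Pinv H (N - 1) m = 1 / (N : ℝ) * (Nat.choose N (m + 1) : ℝ)) :
    binomialForm (certPoly N H q) (∑ j ∈ Finset.Icc 1 N, certPoly N H j) =
      if q = N then 1 / (N : ℝ) else 0 := by
  have hT := X_mul_sum_certPoly (hq1.trans hq) hinv
  rw [binomialForm_comm]
  split_ifs with h
  · rw [h, certPoly_self, binomialForm_one_of_X_mul_eq (by omega) hT]
  · rw [certPoly, if_neg h, map_sum]
    refine Finset.sum_eq_zero fun m hm => ?_
    rw [Finset.mem_Icc] at hm
    rw [map_smul, binomialForm_eq_zero_of_X_mul_eq hm.1 (by omega) hT, smul_zero]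

theorem lamStar_eq_binomialForm {j k : ℕ} (hjk : j < k) (hk : k ≤ N) :
    lamStar N H k j = -(N : ℝ) * binomialForm (certPoly N H k) (certPoly N H j) := by
  have hj : j ≠ N := by omega
  rw [lamStar, binomialForm_comm]
  split_ifs with h
  · rw [h, certPoly_self, binomialForm_one_right, certPoly, if_neg hj, Polynomial.eval_finsetSum,
      neg_mul, ← mul_neg, ← Finset.sum_neg_distrib]
    congr 1
    refine Finset.sum_congr rfl fun m hm => ?_
    obtain ⟨m, rfl⟩ : ∃ n, m = n + 1 := ⟨m - 1, by rw [Finset.mem_Icc] at hm; omega⟩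
    simp [pow_succ, mul_comm]
  · rw [certPoly, if_neg hj, certPoly, if_neg h, LinearMap.map_sum₂, neg_mul, ← mul_neg,
      ← Finset.sum_neg_distrib]
    congr 1
    refine Finset.sum_congr rfl fun l hl => ?_
    rw [map_sum, ← Finset.sum_neg_distrib]
    refine Finset.sum_congr rfl fun m hm => ?_
    obtain ⟨m, rfl⟩ : ∃ n, m = n + 1 := ⟨m - 1, by rw [Finset.mem_Icc] at hm; omega⟩
    rw [map_smul, map_smul, LinearMap.smul_apply, binomialForm_X_pow, ← add_assoc,
      Nat.add_sub_cancel]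
    simp only [smul_eq_mul]
    ring

/-- The `p`-th coordinate of `x_i` for `p ≤ N`. -/
noncomputable def iterCoord (H : ℕ → ℕ → ℝ) (i p : ℕ) : ℝ :=
  -(if p = i then 1 else 0) - 2 * ∑ l ∈ Finset.Ico p i, H l p

theorem iterCoord_self (p : ℕ) : iterCoord H p p = -1 := by simp [iterCoord]

theorem iterCoord_of_lt {i p : ℕ} (h : i < p) : iterCoord H i p = 0 := by
  simp [iterCoord, h.ne', Finset.Ico_eq_empty_of_le h.le]

theorem sum_iterCoord_smul_certPoly {p : ℕ} (hp1 : 1 ≤ p) (hp : p ≤ N) :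
    ∑ j ∈ Finset.Icc 1 N, iterCoord H j p • certPoly N H j =
      -certPoly N H p - (2 : ℝ) • certQuot N H p := by
  have hswap : ∑ j ∈ Finset.Icc 1 N, ∑ l ∈ Finset.Ico p j, H l p • certPoly N H j =
      certQuot N H p := by
    simp only [certQuot, Finset.smul_sum]
    refine Finset.sum_comm' fun j l => ?_
    simp only [Finset.mem_Icc, Finset.mem_Ico, Finset.mem_Ioc]
    omega
  rw [← hswap]
  simp only [iterCoord, sub_smul, neg_smul, ite_smul, one_smul, zero_smul, mul_smul,
    Finset.sum_smul, Finset.sum_sub_distrib, Finset.sum_neg_distrib, Finset.sum_ite_eq,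
    Finset.smul_sum]
  rw [if_pos (Finset.mem_Icc.2 ⟨hp1, hp⟩)]

theorem binomialForm_certPoly_add_certQuot {p q : ℕ} (hp1 : 1 ≤ p) (hp : p ≤ N) (hq1 : 1 ≤ q)
    (hq : q ≤ N) :
    binomialForm (certPoly N H q) (certPoly N H p) + binomialForm (certPoly N H q) (certQuot N H p)
      + binomialForm (certPoly N H p) (certQuot N H q) = if p = N ∧ q = N then 1 else 0 := by
  rcases hp.eq_or_lt with rfl | hp' <;> rcases hq.eq_or_lt with rfl | hq'
  · simp [certPoly_self, certQuot_self, binomialForm_one_right]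
  · rw [certPoly_self, certQuot_self, certPoly_eq_X_mul_certQuot hq1 hq', binomialForm_X_mul_one,
      binomialForm_comm 1]
    simp [hq'.ne]
  · rw [certPoly_self, certQuot_self, binomialForm_comm 1, binomialForm_comm 1,
      certPoly_eq_X_mul_certQuot hp1 hp', binomialForm_X_mul_one]
    simp [hp'.ne]
  · rw [binomialForm_comm (certPoly N H p), certPoly_eq_X_mul_certQuot hp1 hp',
      certPoly_eq_X_mul_certQuot hq1 hq', binomialForm_X_mul_X_mul]
    simp [hp'.ne]

end CertificatePolynomials

section WeightedDifferences

/-- The `q`-th coefficient `∑ j, s_{q,j} (x_q - x_j)` of a weighted graph Laplacian, read off at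
coordinate `p`. -/
noncomputable def lapCoord (N : ℕ) (H s : ℕ → ℕ → ℝ) (q p : ℕ) : ℝ :=
  ∑ j ∈ Finset.Icc 1 N, s q j * (iterCoord H q p - iterCoord H j p)

theorem lapCoord_congr_smul {N : ℕ} {H s t : ℕ → ℕ → ℝ} {β : ℝ} {q : ℕ} (p : ℕ)
    (h : ∀ j, 1 ≤ j → j ≤ N → j ≠ q → s q j = β * t q j) :
    lapCoord N H s q p = β * lapCoord N H t q p := by
  rw [lapCoord, lapCoord, Finset.mul_sum]
  refine Finset.sum_congr rfl fun j hj => ?_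
  rw [Finset.mem_Icc] at hj
  by_cases hjq : j = q
  · simp [hjq]
  · rw [h j hj.1 hj.2 hjq, mul_assoc]

theorem lapCoord_sub_smul (N : ℕ) (H s t : ℕ → ℕ → ℝ) (β : ℝ) (q p : ℕ) :
    lapCoord N H (fun i j => s i j - β * t i j) q p =
      lapCoord N H s q p - β * lapCoord N H t q p := by
  simp only [lapCoord, Finset.mul_sum, ← Finset.sum_sub_distrib]
  exact Finset.sum_congr rfl fun j _ => by ring

theorem sum_lapCoord {N : ℕ} {H s : ℕ → ℕ → ℝ} (hs : ∀ i j, s i j = s j i) (p : ℕ) :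
    ∑ q ∈ Finset.Icc 1 N, lapCoord N H s q p = 0 := by
  have h : ∑ q ∈ Finset.Icc 1 N, lapCoord N H s q p =
      -∑ q ∈ Finset.Icc 1 N, lapCoord N H s q p := by
    conv_lhs => simp only [lapCoord]; rw [Finset.sum_comm]
    simp only [lapCoord, ← Finset.sum_neg_distrib]
    exact Finset.sum_congr rfl fun i _ => Finset.sum_congr rfl fun j _ => by rw [hs]; ring
  linarith

theorem lapCoord_binomialForm {N : ℕ} {H : ℕ → ℕ → ℝ} {p q : ℕ} (hp1 : 1 ≤ p) (hp : p ≤ N)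
    (hq1 : 1 ≤ q) (hq : q ≤ N)
    (hinv : ∀ m, 1 ≤ m → m ≤ N - 1 →
      Pinv H (N - 1) m = 1 / (N : ℝ) * (Nat.choose N (m + 1) : ℝ)) :
    lapCoord N H (fun i j => -(N : ℝ) * binomialForm (certPoly N H i) (certPoly N H j)) q p =
      -(if q = N then iterCoord H N p else 0)
        - N * (binomialForm (certPoly N H q) (certPoly N H p)
          + 2 * binomialForm (certPoly N H q) (certQuot N H p)) := by
  have h1 := binomialForm_certPoly_sum hq1 hq hinv
  have h2 := congrArg (binomialForm (certPoly N H q))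
    (sum_iterCoord_smul_certPoly (H := H) hp1 hp)
  have hN0 : (N : ℝ) ≠ 0 := by
    have : 0 < N := by omega
    positivity
  have h3 : lapCoord N H
      (fun i j => -(N : ℝ) * binomialForm (certPoly N H i) (certPoly N H j)) q p =
      -(N : ℝ) * (iterCoord H q p * binomialForm (certPoly N H q)
        (∑ j ∈ Finset.Icc 1 N, certPoly N H j)
        - binomialForm (certPoly N H q)
          (∑ j ∈ Finset.Icc 1 N, iterCoord H j p • certPoly N H j)) := by
    simp only [lapCoord, map_sum, map_smul, smul_eq_mul, Finset.mul_sum, ← Finset.sum_sub_distrib]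
    exact Finset.sum_congr rfl fun j _ => by ring
  rw [h3, h1, h2, map_sub, map_neg, map_smul, smul_eq_mul]
  split_ifs with h
  · rw [h]
    field_simp
    ring
  · ring

theorem lapCoord_binomialForm_add_swap {N : ℕ} {H : ℕ → ℕ → ℝ} {p q : ℕ} (hp1 : 1 ≤ p) (hp : p ≤ N)
    (hq1 : 1 ≤ q) (hq : q ≤ N)
    (hinv : ∀ m, 1 ≤ m → m ≤ N - 1 →
      Pinv H (N - 1) m = 1 / (N : ℝ) * (Nat.choose N (m + 1) : ℝ)) :
    lapCoord N H (fun i j => -(N : ℝ) * binomialForm (certPoly N H i) (certPoly N H j)) q p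
      + lapCoord N H (fun i j => -(N : ℝ) * binomialForm (certPoly N H i) (certPoly N H j)) p q
      = -(if q = N then iterCoord H N p else 0) - (if p = N then iterCoord H N q else 0)
        - if p = N ∧ q = N then 2 * (N : ℝ) else 0 := by
  have h := binomialForm_certPoly_add_certQuot (H := H) hp1 hp hq1 hq
  rw [lapCoord_binomialForm hp1 hp hq1 hq hinv, lapCoord_binomialForm hq1 hq hp1 hp hinv,
    binomialForm_comm (certPoly N H p) (certPoly N H q)]
  have h' : (if p = N ∧ q = N then 2 * (N : ℝ) else 0) =
      2 * N * if p = N ∧ q = N then (1 : ℝ) else 0 := by split_ifs <;> ring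
  rw [h', ← h]
  ring

theorem eq_zero_of_lapCoord_add_swap_eq_zero {N : ℕ} {H s : ℕ → ℕ → ℝ}
    (hs : ∀ i j, s i j = s j i)
    (h : ∀ p q, 1 ≤ p → p ≤ N → 1 ≤ q → q ≤ N → lapCoord N H s q p + lapCoord N H s p q = 0)
    {i j : ℕ} (hj : 1 ≤ j) (hji : j < i) (hi : i ≤ N) : s i j = 0 := by
  induction hn : N - i using Nat.strong_induction_on generalizing i j with
  | _ n ihi =>
    replace ihi : ∀ i' j', i < i' → i' ≤ N → 1 ≤ j' → j' < i' → s i' j' = 0 :=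
      fun i' j' h1 h2 h3 h4 => ihi (N - i') (by omega) h3 h4 h2 rfl
    have hrow : ∀ p, lapCoord N H s i p =
        ∑ r ∈ Finset.Ico 1 i, s i r * (iterCoord H i p - iterCoord H r p) := fun p => by
      rw [lapCoord]
      symm
      refine Finset.sum_subset (fun r hr => ?_) fun r hr hr' => ?_
      · simp only [Finset.mem_Ico, Finset.mem_Icc] at hr ⊢
        omega
      · simp only [Finset.mem_Ico, Finset.mem_Icc] at hr hr'
        rcases (show r = i ∨ i < r by omega) with rfl | hir
        · simp
        · rw [hs, ihi r i hir hr.2 (by omega) hir, zero_mul]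
    have hsum : ∑ r ∈ Finset.Ico 1 i, s i r = 0 := by
      have hii := h i i (by omega) hi (by omega) hi
      rw [hrow] at hii
      have : ∑ r ∈ Finset.Ico 1 i, s i r * (iterCoord H i i - iterCoord H r i) =
          -∑ r ∈ Finset.Ico 1 i, s i r := by
        rw [← Finset.sum_neg_distrib]
        refine Finset.sum_congr rfl fun r hr => ?_
        rw [iterCoord_self, iterCoord_of_lt (Finset.mem_Ico.1 hr).2]
        ring
      linarith
    induction hm : i - j using Nat.strong_induction_on generalizing j with
    | _ m ihj =>
      replace ihj : ∀ r, j < r → r < i → s i r = 0 :=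
        fun r h1 h2 => ihj (i - r) (by omega) (by omega) h2 rfl
      have h1 : lapCoord N H s j i = s i j := by
        rw [lapCoord, Finset.sum_eq_single i]
        · rw [iterCoord_self, iterCoord_of_lt hji, hs]
          ring
        · intro r hr hri
          rw [Finset.mem_Icc] at hr
          rcases lt_or_gt_of_ne hri with hlt | hgt
          · rw [iterCoord_of_lt hlt, iterCoord_of_lt hji, sub_zero, mul_zero]
          · rw [hs, ihi r j hgt hr.2 hj (by omega), zero_mul]
        · intro hni
          exact absurd (Finset.mem_Icc.2 ⟨by omega, hi⟩) hni
      have h2 : lapCoord N H s i j = s i j := by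
        rw [hrow]
        simp only [mul_sub, Finset.sum_sub_distrib]
        rw [← Finset.sum_mul, hsum, Finset.sum_eq_single j]
        · rw [iterCoord_self]
          ring
        · intro r hr hrj
          rw [Finset.mem_Ico] at hr
          rcases lt_or_gt_of_ne hrj with hlt | hgt
          · rw [iterCoord_of_lt hlt, mul_zero]
          · rw [ihj r hgt hr.2, zero_mul]
        · intro hnj
          exact absurd (Finset.mem_Ico.2 ⟨hj, hji⟩) hnj
      have := h j i hj (by omega) (by omega) hi
      linarith

/-- Summation by parts for a weighted graph Laplacian. -/
theorem sum_weighted_diff_mul_diff (s : ℕ → ℕ → ℝ) (hs : ∀ i j, s i j = s j i) (x u : ℕ → ℝ)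
    (N : ℕ) :
    ∑ i ∈ Finset.Icc 2 N, ∑ j ∈ Finset.Icc 1 (i - 1), s i j * ((x i - x j) * (u i - u j)) =
      ∑ i ∈ Finset.Icc 1 N, u i * ∑ j ∈ Finset.Icc 1 N, s i j * (x i - x j) := by
  induction N with
  | zero => simp
  | succ N ih =>
    rcases Nat.eq_zero_or_pos N with rfl | hN
    · simp
    · rw [Finset.sum_Icc_succ_top (by omega), ih, Nat.add_sub_cancel]
      simp only [Finset.sum_Icc_succ_top (show 1 ≤ N + 1 by omega), sub_self, mul_zero, add_zero,
        mul_add, Finset.sum_add_distrib, add_assoc]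
      congr 1
      rw [Finset.mul_sum, ← Finset.sum_add_distrib]
      refine Finset.sum_congr rfl fun j _ => ?_
      rw [hs j]
      ring

end WeightedDifferences

section MatrixEntries

theorem ebasis_apply (N j : ℕ) (α : Fin (N + 1)) :
    ebasis N j α = if (α : ℕ) + 1 = j then 1 else 0 := rfl

theorem iterate_apply {N : ℕ} {H : ℕ → ℕ → ℝ} {y x : ℕ → Fin (N + 1) → ℝ}
    (hy0 : y 0 = ebasis N (N + 1))
    (hyrec : ∀ i, 1 ≤ i → i ≤ N - 1 →
      y i = y (i - 1) - ∑ j ∈ Finset.Icc 1 i, (2 * H i j) • ebasis N j)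
    (hx : ∀ i, 1 ≤ i → i ≤ N → x i = y (i - 1) - ebasis N i)
    {i : ℕ} (hi1 : 1 ≤ i) (hi : i ≤ N) (α : Fin (N + 1)) :
    x i α = (if (α : ℕ) = N then 1 else 0) + iterCoord H i (α + 1) := by
  have hy : ∀ n, n ≤ N - 1 → y n α =
      (if (α : ℕ) = N then 1 else 0) - 2 * ∑ l ∈ Finset.Ico ((α : ℕ) + 1) (n + 1), H l (α + 1) := by
    intro n hn
    induction n with
    | zero => simp [hy0, ebasis_apply]
    | succ n ih =>
      rw [hyrec _ (by omega) hn, Nat.add_sub_cancel, Pi.sub_apply, ih (by omega),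
        Finset.sum_apply]
      simp only [Pi.smul_apply, ebasis_apply, smul_eq_mul, mul_ite, mul_one, mul_zero,
        Finset.sum_ite_eq, Finset.mem_Icc]
      split_ifs with h1 h2 h2
      all_goals first
        | omega
        | (rw [Finset.sum_Ico_succ_top (b := n + 1) (by omega)]; ring)
        | simp [Finset.Ico_eq_empty_of_le (show n + 1 + 1 ≤ (α : ℕ) + 1 by omega),
            Finset.Ico_eq_empty_of_le (show n + 1 ≤ (α : ℕ) + 1 by omega)]
  rw [hx i hi1 hi, Pi.sub_apply, hy _ (by omega), ebasis_apply, iterCoord, Nat.sub_add_cancel hi1]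
  ring

theorem sum_ebasis_mul {N : ℕ} (α : Fin (N + 1)) (g : ℕ → ℝ) :
    ∑ i ∈ Finset.Icc 1 N, ebasis N i α * g i = if (α : ℕ) = N then 0 else g (α + 1) := by
  have := α.isLt
  simp only [ebasis_apply, ite_mul, one_mul, zero_mul, Finset.sum_ite_eq, Finset.mem_Icc]
  split_ifs <;> first | rfl | omega

theorem certificate_sum_eq_zero_iff (N : ℕ) (H : ℕ → ℕ → ℝ)
    (y : ℕ → Fin (N + 1) → ℝ) (hy0 : y 0 = ebasis N (N + 1))
    (hyrec : ∀ i, 1 ≤ i → i ≤ N - 1 →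
      y i = y (i - 1) - ∑ j ∈ Finset.Icc 1 i, (2 * H i j) • ebasis N j)
    (x : ℕ → Fin (N + 1) → ℝ) (hx : ∀ i, 1 ≤ i → i ≤ N → x i = y (i - 1) - ebasis N i)
    (A : ℕ → ℕ → Matrix (Fin (N + 1)) (Fin (N + 1)) ℝ)
    (hA : ∀ i j, 1 ≤ j → j < i → i ≤ N →
      A i j = (1 / 2 : ℝ) •
        (Matrix.vecMulVec (x i - x j) (ebasis N i - ebasis N j)
          + Matrix.vecMulVec (ebasis N i - ebasis N j) (x i - x j)))
    (B : ℕ → Matrix (Fin (N + 1)) (Fin (N + 1)) ℝ)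
    (hB : ∀ i, 1 ≤ i → i ≤ N →
      B i = (1 / 2 : ℝ) •
        (Matrix.vecMulVec (x i) (ebasis N i) + Matrix.vecMulVec (ebasis N i) (x i)))
    (Cm : Matrix (Fin (N + 1)) (Fin (N + 1)) ℝ)
    (hC : Cm = Matrix.vecMulVec (ebasis N (N + 1)) (ebasis N (N + 1)))
    (Dm : Matrix (Fin (N + 1)) (Fin (N + 1)) ℝ)
    (hD : Dm = Matrix.of fun a b : Fin (N + 1) =>
      if (a : ℕ) + 1 = N ∧ (b : ℕ) + 1 = N then 1
      else if ((a : ℕ) + 1 = N ∧ (b : ℕ) = N) ∨ ((a : ℕ) = N ∧ (b : ℕ) + 1 = N) then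
        -(1 / (N : ℝ))
      else 0)
    (Em : Matrix (Fin (N + 1)) (Fin (N + 1)) ℝ)
    (hE : Em = Matrix.of fun a b : Fin (N + 1) =>
      if (a : ℕ) + 1 = N ∧ (b : ℕ) + 1 = N then (1 : ℝ) else 0)
    (s : ℕ → ℕ → ℝ) (hs : ∀ i j, s i j = s j i) (b : ℕ → ℝ) (c d e : ℝ) :
    ((∑ i ∈ Finset.Icc 2 N, ∑ j ∈ Finset.Icc 1 (i - 1), s i j • A i j)
        + (∑ i ∈ Finset.Icc 1 N, b i • B i) + c • Cm + d • Dm + e • Em = 0) ↔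
    (c = 0 ∧ (∀ q, 1 ≤ q → q ≤ N → b q = if q = N then 2 * d / (N : ℝ) else 0) ∧
      ∀ p q, 1 ≤ p → p ≤ N → 1 ≤ q → q ≤ N →
        lapCoord N H s q p + lapCoord N H s p q + b q * iterCoord H q p + b p * iterCoord H p q
          + (if p = N ∧ q = N then 2 * (d + e) else 0) = 0) := by
  have hX := fun i (hi1 : 1 ≤ i) (hi : i ≤ N) => iterate_apply hy0 hyrec hx hi1 hi
  have hAs : ∀ α β, (∑ i ∈ Finset.Icc 2 N, ∑ j ∈ Finset.Icc 1 (i - 1), s i j • A i j) α β =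
      1 / 2 * ((if (β : ℕ) = N then 0 else lapCoord N H s (β + 1) (α + 1))
        + if (α : ℕ) = N then 0 else lapCoord N H s (α + 1) (β + 1)) := by
    intro α β
    rw [← sum_ebasis_mul β fun q => lapCoord N H s q (α + 1),
      ← sum_ebasis_mul α fun q => lapCoord N H s q (β + 1)]
    simp only [lapCoord]
    rw [← sum_weighted_diff_mul_diff s hs (fun i => iterCoord H i (α + 1)) fun i => ebasis N i β,
      ← sum_weighted_diff_mul_diff s hs (fun i => iterCoord H i (β + 1)) fun i => ebasis N i α,
      ← Finset.sum_add_distrib, Finset.mul_sum, Matrix.sum_apply]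
    refine Finset.sum_congr rfl fun i hi => ?_
    rw [← Finset.sum_add_distrib, Finset.mul_sum, Matrix.sum_apply]
    refine Finset.sum_congr rfl fun j hj => ?_
    rw [Finset.mem_Icc] at hi hj
    rw [hA i j hj.1 (by omega) hi.2]
    simp only [Matrix.smul_apply, Matrix.add_apply, Matrix.vecMulVec_apply, Pi.sub_apply,
      smul_eq_mul]
    rw [hX i (by omega) hi.2, hX i (by omega) hi.2, hX j hj.1 (by omega), hX j hj.1 (by omega)]
    ring
  have hBs : ∀ α β, (∑ i ∈ Finset.Icc 1 N, b i • B i) α β =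
      1 / 2 * ((if (β : ℕ) = N then 0 else
          b (β + 1) * ((if (α : ℕ) = N then 1 else 0) + iterCoord H (β + 1) (α + 1)))
        + if (α : ℕ) = N then 0 else
          b (α + 1) * ((if (β : ℕ) = N then 1 else 0) + iterCoord H (α + 1) (β + 1))) := by
    intro α β
    rw [← sum_ebasis_mul β fun q => b q * ((if (α : ℕ) = N then 1 else 0) + iterCoord H q (α + 1)),
      ← sum_ebasis_mul α fun q => b q * ((if (β : ℕ) = N then 1 else 0) + iterCoord H q (β + 1)),
      ← Finset.sum_add_distrib, Finset.mul_sum, Matrix.sum_apply]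
    refine Finset.sum_congr rfl fun i hi => ?_
    rw [Finset.mem_Icc] at hi
    rw [hB i hi.1 hi.2]
    simp only [Matrix.smul_apply, Matrix.add_apply, Matrix.vecMulVec_apply, smul_eq_mul]
    rw [hX i hi.1 hi.2, hX i hi.1 hi.2]
    ring
  have hlast : ∀ q, q ≤ N → iterCoord H q (N + 1) = 0 := fun q hq => iterCoord_of_lt (by omega)
  have hlap : ∀ q, q ≤ N → lapCoord N H s q (N + 1) = 0 := fun q hq =>
    Finset.sum_eq_zero fun j hj => by
      rw [hlast q hq, hlast j (Finset.mem_Icc.1 hj).2, sub_zero, mul_zero]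
  rw [← Matrix.ext_iff]
  simp only [Matrix.add_apply, hAs, hBs, Matrix.smul_apply, hC, hD, hE, Matrix.vecMulVec_apply,
    Matrix.of_apply, ebasis_apply, smul_eq_mul, Matrix.zero_apply, Nat.add_right_cancel_iff]
  constructor
  · intro h
    refine ⟨?_, fun q hq1 hq => ?_, fun p q hp1 hp hq1 hq => ?_⟩
    · simpa using h (Fin.last N) (Fin.last N)
    · have h1 := h (Fin.last N) ⟨q - 1, by omega⟩
      have h3 : q - 1 ≠ N := by omega
      simp [Nat.sub_add_cancel hq1, hlast q hq, h3, hlap q hq] at h1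
      split_ifs at h1 ⊢ with h4
      · linear_combination 2 * h1
      · linarith
    · have h1 := h ⟨p - 1, by omega⟩ ⟨q - 1, by omega⟩
      have h3 : q - 1 ≠ N := by omega
      have h5 : p - 1 ≠ N := by omega
      simp only [Nat.sub_add_cancel hq1, Nat.sub_add_cancel hp1, h3, h5, if_false,
        and_false, false_and, or_false, zero_add, mul_zero, add_zero] at h1
      split_ifs at h1 ⊢ <;> linarith
  · rintro ⟨hc, hb, hM⟩ α β
    have hα := α.isLt
    have hβ := β.isLt
    by_cases h1 : (α : ℕ) = N <;> by_cases h2 : (β : ℕ) = N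
    · simp [h1, h2, hc]
    · have h3 := hb (β + 1) (by omega) (by omega)
      simp [h1, h2, h3, hc, hlast (β + 1) (by omega), hlap (β + 1) (by omega)]
      split_ifs <;> ring
    · have h3 := hb (α + 1) (by omega) (by omega)
      simp [h1, h2, h3, hc, hlast (α + 1) (by omega), hlap (α + 1) (by omega)]
      split_ifs <;> ring
    · have h3 := hM (α + 1) (β + 1) (by omega) (by omega) (by omega) (by omega)
      simp only [h1, h2, hc, if_false, and_false, false_and, or_false, zero_add, zero_mul, add_zero]
      split_ifs at h3 ⊢ <;> linarith

end MatrixEntries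

/-- **Uniqueness of the certificate decomposition (Lemma 6.6).**
In `ℝ^{N+1}`, with `g_i = e_i`, `y₀ = e_{N+1}`, `y_i = y_{i−1} − Σ_{j=1}^{i} 2h_{i,j}·e_j`,
`x_i = y_{i−1} − e_i`, and the symmetric matrices `A_{i,j}`, `B_i`, `C`, `D`, `E` as in the
paper, the identity
`Σ_{i=2}^{N} Σ_{j=1}^{i−1} a_{i,j}·A_{i,j} + Σ_{i=1}^{N} b_i·B_i + c·C + d·D + e·E = 0`
holds iff `d = e`, `c = 0`, `b_i = 0` for `i ≤ N−1`, `b_N = 2d/N`, and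
`a_{i,j} = b_N·λ*_{i,j}(H)` for all `1 ≤ j < i ≤ N`. -/
theorem certificate_decomposition_unique (N : ℕ) (hN : 2 ≤ N) (H : ℕ → ℕ → ℝ)
    (hinv : ∀ m, 1 ≤ m → m ≤ N - 1 →
      Pinv H (N - 1) m = 1 / (N : ℝ) * (Nat.choose N (m + 1) : ℝ))
    (y : ℕ → Fin (N + 1) → ℝ) (hy0 : y 0 = ebasis N (N + 1))
    (hyrec : ∀ i, 1 ≤ i → i ≤ N - 1 →
      y i = y (i - 1) - ∑ j ∈ Finset.Icc 1 i, (2 * H i j) • ebasis N j)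
    (x : ℕ → Fin (N + 1) → ℝ) (hx : ∀ i, 1 ≤ i → i ≤ N → x i = y (i - 1) - ebasis N i)
    (A : ℕ → ℕ → Matrix (Fin (N + 1)) (Fin (N + 1)) ℝ)
    (hA : ∀ i j, 1 ≤ j → j < i → i ≤ N →
      A i j = (1 / 2 : ℝ) •
        (Matrix.vecMulVec (x i - x j) (ebasis N i - ebasis N j)
          + Matrix.vecMulVec (ebasis N i - ebasis N j) (x i - x j)))
    (B : ℕ → Matrix (Fin (N + 1)) (Fin (N + 1)) ℝ)
    (hB : ∀ i, 1 ≤ i → i ≤ N →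
      B i = (1 / 2 : ℝ) •
        (Matrix.vecMulVec (x i) (ebasis N i) + Matrix.vecMulVec (ebasis N i) (x i)))
    (Cm : Matrix (Fin (N + 1)) (Fin (N + 1)) ℝ)
    (hC : Cm = Matrix.vecMulVec (ebasis N (N + 1)) (ebasis N (N + 1)))
    (Dm : Matrix (Fin (N + 1)) (Fin (N + 1)) ℝ)
    (hD : Dm = Matrix.of fun a b : Fin (N + 1) =>
      if (a : ℕ) + 1 = N ∧ (b : ℕ) + 1 = N then 1
      else if ((a : ℕ) + 1 = N ∧ (b : ℕ) = N) ∨ ((a : ℕ) = N ∧ (b : ℕ) + 1 = N) then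
        -(1 / (N : ℝ))
      else 0)
    (Em : Matrix (Fin (N + 1)) (Fin (N + 1)) ℝ)
    (hE : Em = Matrix.of fun a b : Fin (N + 1) =>
      if (a : ℕ) + 1 = N ∧ (b : ℕ) + 1 = N then (1 : ℝ) else 0)
    (a : ℕ → ℕ → ℝ) (b : ℕ → ℝ) (c d e : ℝ) :
    ((∑ i ∈ Finset.Icc 2 N, ∑ j ∈ Finset.Icc 1 (i - 1), a i j • A i j)
        + (∑ i ∈ Finset.Icc 1 N, b i • B i) + c • Cm + d • Dm + e • Em = 0) ↔
    (d = e ∧ c = 0 ∧ (∀ i, 1 ≤ i → i ≤ N - 1 → b i = 0) ∧ b N = 2 * d / (N : ℝ) ∧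
      ∀ i j, 1 ≤ j → j < i → i ≤ N → a i j = b N * lamStar N H i j) := by
  have hN1 : 1 ≤ N := by omega
  have hN0 : (N : ℝ) ≠ 0 := by positivity
  set s : ℕ → ℕ → ℝ := fun i j => if j < i then a i j else a j i with hs_def
  have hs : ∀ i j, s i j = s j i := fun i j => by
    rcases lt_trichotomy i j with h | rfl | h
    · simp [hs_def, h, h.not_gt]
    · rfl
    · simp [hs_def, h, h.not_gt]
  have hsa : ∀ i j, j < i → s i j = a i j := fun i j h => if_pos h
  set t : ℕ → ℕ → ℝ := fun i j =>
    -(N : ℝ) * binomialForm (certPoly N H i) (certPoly N H j) with ht_def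
  have ht : ∀ i j, t i j = t j i := fun i j => by simp only [ht_def, binomialForm_comm]
  have htl : ∀ i j, j < i → i ≤ N → lamStar N H i j = t i j :=
    fun i j h hi => lamStar_eq_binomialForm h hi
  have hT : ∀ p q, 1 ≤ p → p ≤ N → 1 ≤ q → q ≤ N →
      lapCoord N H t q p + lapCoord N H t p q =
        -(if q = N then iterCoord H N p else 0) - (if p = N then iterCoord H N q else 0)
        - if p = N ∧ q = N then 2 * (N : ℝ) else 0 :=
    fun p q hp1 hp hq1 hq => lapCoord_binomialForm_add_swap hp1 hp hq1 hq hinv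
  have hsum : ∑ i ∈ Finset.Icc 2 N, ∑ j ∈ Finset.Icc 1 (i - 1), a i j • A i j =
      ∑ i ∈ Finset.Icc 2 N, ∑ j ∈ Finset.Icc 1 (i - 1), s i j • A i j := by
    refine Finset.sum_congr rfl fun i hi => Finset.sum_congr rfl fun j hj => ?_
    rw [Finset.mem_Icc] at hi hj
    rw [hsa i j (by omega)]
  have hbi : ∀ p q, (∀ q, 1 ≤ q → q ≤ N → b q = if q = N then 2 * d / (N : ℝ) else 0) →
      1 ≤ q → q ≤ N →
      b q * iterCoord H q p = 2 * d / N * if q = N then iterCoord H N p else 0 := by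
    intro p q hb hq1 hq
    rw [hb q hq1 hq]
    split_ifs with h
    · rw [h]
    · ring
  rw [hsum, certificate_sum_eq_zero_iff N H y hy0 hyrec x hx A hA B hB Cm hC Dm hD Em hE s hs]
  constructor
  · rintro ⟨hc, hb, hM⟩
    have hbN : b N = 2 * d / N := by rw [hb N hN1 le_rfl, if_pos rfl]
    set r : ℕ → ℕ → ℝ := fun i j => s i j - 2 * d / N * t i j with hr_def
    have hr : ∀ i j, r i j = r j i := fun i j => by simp only [hr_def, hs i j, ht i j]
    have hR : ∀ p q, 1 ≤ p → p ≤ N → 1 ≤ q → q ≤ N →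
        lapCoord N H r q p + lapCoord N H r p q =
          if p = N ∧ q = N then 2 * (d - e) else 0 := by
      intro p q hp1 hp hq1 hq
      have h1 := hM p q hp1 hp hq1 hq
      have h2 := hT p q hp1 hp hq1 hq
      rw [hbi p q hb hq1 hq, hbi q p hb hp1 hp] at h1
      have h3 : lapCoord N H r q p + lapCoord N H r p q =
          lapCoord N H s q p + lapCoord N H s p q
            - 2 * d / N * (lapCoord N H t q p + lapCoord N H t p q) := by
        rw [lapCoord_sub_smul, lapCoord_sub_smul]
        ring
      rw [h3, h2]
      have h4 : 2 * d / N * (2 * N) = 4 * d := by field_simp; ring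
      split_ifs at h1 ⊢ <;> linarith
    have hde : d = e := by
      have h1 : ∑ p ∈ Finset.Icc 1 N, ∑ q ∈ Finset.Icc 1 N,
          (lapCoord N H r q p + lapCoord N H r p q) = 2 * (d - e) := by
        rw [Finset.sum_congr rfl fun p hp => Finset.sum_congr rfl fun q hq =>
          hR p q (Finset.mem_Icc.1 hp).1 (Finset.mem_Icc.1 hp).2 (Finset.mem_Icc.1 hq).1
            (Finset.mem_Icc.1 hq).2]
        simp [ite_and, hN1]
      simp only [Finset.sum_add_distrib, sum_lapCoord hr, Finset.sum_const_zero] at h1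
      rw [Finset.sum_comm] at h1
      simp only [sum_lapCoord hr, Finset.sum_const_zero] at h1
      linarith
    refine ⟨hde, hc, fun i hi1 hi => ?_, hbN, fun i j hj hji hi => ?_⟩
    · rw [hb i hi1 (by omega), if_neg (by omega)]
    · have := eq_zero_of_lapCoord_add_swap_eq_zero hr (fun p q hp1 hp hq1 hq => by
        rw [hR p q hp1 hp hq1 hq, hde, sub_self, mul_zero, ite_self]) hj hji hi
      rw [htl i j hji hi, hbN, ← hsa i j hji]
      exact sub_eq_zero.1 this
  · rintro ⟨hde, hc, hb, hbN, ha⟩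
    have hb' : ∀ q, 1 ≤ q → q ≤ N → b q = if q = N then 2 * d / (N : ℝ) else 0 := by
      intro q hq1 hq
      split_ifs with h
      · rw [h, hbN]
      · exact hb q hq1 (by omega)
    refine ⟨hc, hb', fun p q hp1 hp hq1 hq => ?_⟩
    have hL : ∀ p q, 1 ≤ q → q ≤ N → lapCoord N H s q p = 2 * d / N * lapCoord N H t q p := by
      intro p q hq1 hq
      refine lapCoord_congr_smul p fun j hj1 hj hjq => ?_
      rcases lt_or_gt_of_ne hjq with h | h
      · rw [hsa q j h, ha q j hj1 h hq, hbN, htl q j h hq]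
      · rw [hs, ht, hsa j q h, ha j q hq1 h hj, hbN, htl j q h hj]
    rw [hL p q hq1 hq, hL q p hp1 hp, ← mul_add, hT p q hp1 hp hq1 hq, hbi p q hb' hq1 hq,
      hbi q p hb' hp1 hp, ← hde]
    have h4 : 2 * d / N * (2 * N) = 4 * d := by field_simp; ring
    split_ifs <;> linarith
end
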